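/- Let d, T be natural numbers with 1 ≤ T. For each t ∈ {1, …, T} let q t : (Fin d → ℝ) → (Fin d → ℝ) → ℝ≥0∞ be measurable with ∫⁻ q t z w dw = 1 for every z (a Markov transition density with respect to Lebesgue measure). Fix z0 : Fin d → ℝ; define the joint density Q z = ∏_{t=1}^{T} q t (z_{t−1}) (z_t) on trajectories z : Fin T → (Fin d → ℝ) (with z_0 := z0), and marginals m 1 = q 1 z0 and m t b = ∫⁻ m (t−1) a * q t a b da for 2 ≤ t ≤ T. Then for every t with 2 ≤ t ≤ T and every measurable f : (Fin d → ℝ) → (Fin d → ℝ) → ℝ≥0∞, ∫⁻ Q z * f (z_{t−1}) (z_t) dz = ∫⁻ ∫⁻ m (t−1) a * q t a b * f a b db da, where the left-hand integral is over trajectories z : Fin T → (Fin d → ℝ) with respect to Lebesgue (volume) measure. -/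

import Mathlib

open MeasureTheory ENNReal

/-- Extend a trajectory `z : Fin T → α` (holding `z_1, …, z_T`) to an index `t : ℕ`,
with `z_0 := z0`. -/
def traj {α : Type*} {T : ℕ} (z0 : α) (z : Fin T → α) (t : ℕ) : α :=
  if h : 1 ≤ t ∧ t ≤ T then z ⟨t - 1, by omega⟩ else z0

/-- Time-`t` marginal density of the forward Markov process started at `z0`:
`m 1 = q 1 z0` and `m t b = ∫⁻ m (t-1) a * q t a b da` for `t ≥ 2`. -/
noncomputable def marg {d : ℕ} (q : ℕ → (Fin d → ℝ) → (Fin d → ℝ) → ℝ≥0∞)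
    (z0 : Fin d → ℝ) : ℕ → (Fin d → ℝ) → ℝ≥0∞
  | 0 => fun _ => 0
  | 1 => q 1 z0
  | (t + 2) => fun b => ∫⁻ a, marg q z0 (t + 1) a * q (t + 2) a b

lemma traj_meas {d n : ℕ} (z0 : Fin d → ℝ) (t : ℕ) :
    Measurable (fun z : Fin n → (Fin d → ℝ) => traj z0 z t) := by
  unfold traj
  split_ifs
  · exact measurable_pi_apply _
  · exact measurable_const

lemma traj_snoc_le {d n : ℕ} (z0 : Fin d → ℝ) (z : Fin n → (Fin d → ℝ)) (w : Fin d → ℝ)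
    (t : ℕ) (ht : t ≤ n) :
    traj z0 (Fin.snoc z w : Fin (n + 1) → (Fin d → ℝ)) t = traj z0 z t := by
  unfold traj
  by_cases h : 1 ≤ t
  · rw [dif_pos ⟨h, by omega⟩, dif_pos ⟨h, ht⟩]
    have : (⟨t - 1, by omega⟩ : Fin (n + 1)) = Fin.castSucc ⟨t - 1, by omega⟩ := rfl
    rw [this, Fin.snoc_castSucc (α := fun _ => Fin d → ℝ)]
  · rw [dif_neg (by omega), dif_neg (by omega)]

lemma traj_snoc_last {d n : ℕ} (z0 : Fin d → ℝ) (z : Fin n → (Fin d → ℝ)) (w : Fin d → ℝ) :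
    traj z0 (Fin.snoc z w : Fin (n + 1) → (Fin d → ℝ)) (n + 1) = w := by
  unfold traj
  rw [dif_pos ⟨by omega, le_rfl⟩]
  exact Fin.snoc_last (α := fun _ => Fin d → ℝ) w z

lemma lintegral_snoc {d n : ℕ} (F : (Fin (n + 1) → (Fin d → ℝ)) → ℝ≥0∞) (hF : Measurable F) :
    ∫⁻ z, F z = ∫⁻ z : Fin n → (Fin d → ℝ), ∫⁻ w, F (Fin.snoc z w) := by
  have h := (volume_preserving_piFinSuccAbove (fun _ : Fin (n + 1) => (Fin d → ℝ))
    (Fin.last n)).symm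
  rw [← h.lintegral_comp hF]
  change ∫⁻ p, _ ∂(Measure.prod volume volume) = _
  refine (lintegral_prod_symm _ (hF.comp h.measurable).aemeasurable).trans ?_
  refine lintegral_congr fun z => lintegral_congr fun w => ?_
  simp [MeasurableEquiv.piFinSuccAbove, Fin.insertNthEquiv]

lemma lintegral_Q_succ {d n : ℕ} (q : ℕ → (Fin d → ℝ) → (Fin d → ℝ) → ℝ≥0∞)
    (hq : ∀ t, 1 ≤ t → t ≤ n + 1 →
      Measurable (fun pr : (Fin d → ℝ) × (Fin d → ℝ) => q t pr.1 pr.2))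
    (z0 : Fin d → ℝ) (s t : ℕ)
    (f : (Fin d → ℝ) → (Fin d → ℝ) → ℝ≥0∞)
    (hf : Measurable (fun pr : (Fin d → ℝ) × (Fin d → ℝ) => f pr.1 pr.2)) :
    (∫⁻ z : Fin (n + 1) → (Fin d → ℝ),
            (∏ s ∈ Finset.Icc 1 (n + 1), q s (traj z0 z (s - 1)) (traj z0 z s)) *
              f (traj z0 z s) (traj z0 z t)) =
    ∫⁻ z : Fin n → (Fin d → ℝ),
            (∏ s ∈ Finset.Icc 1 n, q s (traj z0 z (s - 1)) (traj z0 z s)) *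
              ∫⁻ w, q (n + 1) (traj z0 z n) w *
                f (traj z0 (Fin.snoc z w : Fin (n + 1) → (Fin d → ℝ)) s)
                  (traj z0 (Fin.snoc z w : Fin (n + 1) → (Fin d → ℝ)) t) := by
  have hm : ∀ r, Measurable (fun z : Fin (n + 1) → (Fin d → ℝ) => traj z0 z r) :=
    fun r => traj_meas z0 r
  rw [lintegral_snoc]
  · refine lintegral_congr fun z => ?_
    have hsn : Measurable (fun w : Fin d → ℝ => (Fin.snoc z w : Fin (n + 1) → (Fin d → ℝ))) := by
      refine measurable_pi_lambda _ fun i => ?_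
      refine Fin.lastCases ?_ (fun j => ?_) i
      · simp only [Fin.snoc_last]
        exact measurable_id
      · simp
    rw [← lintegral_const_mul]
    · refine lintegral_congr fun w => ?_
      rw [Finset.prod_Icc_succ_top (by omega), mul_assoc]
      congr 1
      · refine Finset.prod_congr rfl fun s hs => ?_
        rw [Finset.mem_Icc] at hs
        rw [traj_snoc_le _ _ _ _ (by omega), traj_snoc_le _ _ _ _ (by omega)]
      · rw [traj_snoc_last, Nat.add_sub_cancel, traj_snoc_le _ _ _ _ le_rfl]
    · refine Measurable.mul ?_ ?_
      · exact (hq (n + 1) (by omega) le_rfl).comp (measurable_const.prodMk measurable_id)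
      · exact hf.comp (((hm s).comp hsn).prodMk ((hm t).comp hsn))
  · refine Measurable.mul ?_ (hf.comp ((hm s).prodMk (hm t)))
    refine Finset.measurable_prod _ fun r hr => ?_
    rw [Finset.mem_Icc] at hr
    exact (hq r hr.1 hr.2).comp ((hm (r - 1)).prodMk (hm r))

lemma marg_meas {d : ℕ} (q : ℕ → (Fin d → ℝ) → (Fin d → ℝ) → ℝ≥0∞) (z0 : Fin d → ℝ) (n : ℕ)
    (hq : ∀ t, 1 ≤ t → t ≤ n + 1 →
      Measurable (fun pr : (Fin d → ℝ) × (Fin d → ℝ) => q t pr.1 pr.2)) :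
    Measurable (marg q z0 (n + 1)) := by
  induction n with
  | zero => exact (hq 1 le_rfl le_rfl).comp (measurable_const.prodMk measurable_id)
  | succ n ih =>
    have h1 := ih fun t h h' => hq t h (by omega)
    have h2 := hq (n + 2) (by omega) le_rfl
    exact Measurable.lintegral_prod_left' (f := fun p : (Fin d → ℝ) × (Fin d → ℝ) =>
      marg q z0 (n + 1) p.1 * q (n + 2) p.1 p.2) ((h1.comp measurable_fst).mul h2)

lemma single_marg {d : ℕ} (q : ℕ → (Fin d → ℝ) → (Fin d → ℝ) → ℝ≥0∞) (z0 : Fin d → ℝ) (n : ℕ)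
    (hq : ∀ t, 1 ≤ t → t ≤ n + 1 →
      Measurable (fun pr : (Fin d → ℝ) × (Fin d → ℝ) => q t pr.1 pr.2))
    (g : (Fin d → ℝ) → ℝ≥0∞) (hg : Measurable g) :
    (∫⁻ z : Fin (n + 1) → (Fin d → ℝ),
            (∏ s ∈ Finset.Icc 1 (n + 1), q s (traj z0 z (s - 1)) (traj z0 z s)) *
              g (traj z0 z (n + 1))) = ∫⁻ b, marg q z0 (n + 1) b * g b := by
  induction n generalizing g with
  | zero =>
    rw [lintegral_Q_succ q hq z0 1 1 (fun _ b => g b) (hg.comp measurable_snd)]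
    simp only [traj_snoc_last]
    rw [lintegral_unique]
    simp [traj, marg, volume_pi]
  | succ n ih =>
    rw [lintegral_Q_succ q hq z0 1 (n + 1 + 1) (fun _ b => g b) (hg.comp measurable_snd)]
    simp only [traj_snoc_last]
    have h2 := hq (n + 2) (by omega) le_rfl
    have h3 : Measurable (fun p : (Fin d → ℝ) × (Fin d → ℝ) => q (n + 2) p.1 p.2 * g p.2) :=
      h2.mul (hg.comp measurable_snd)
    have h1 := marg_meas q z0 n fun t h h' => hq t h (by omega)
    rw [ih (fun t h h' => hq t h (by omega)) (fun a => ∫⁻ w, q (n + 2) a w * g w)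
      h3.lintegral_prod_right']
    have e : ∀ a, marg q z0 (n + 1) a * ∫⁻ w, q (n + 2) a w * g w
        = ∫⁻ w, marg q z0 (n + 1) a * (q (n + 2) a w * g w) := fun a =>
      (lintegral_const_mul _ (h3.comp (measurable_const.prodMk measurable_id))).symm
    simp only [e]
    rw [lintegral_lintegral_swap ((h1.comp measurable_fst).mul h3).aemeasurable]
    refine lintegral_congr fun b => ?_
    rw [marg, ← lintegral_mul_const]
    · simp only [mul_assoc]
    · exact h1.mul (h2.comp (measurable_id.prodMk measurable_const))

/-- the joint law of `(z_{t-1}, z_t)` under the trajectory density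
`Q z = ∏_{t=1}^{T} q t (z_{t-1}) (z_t)` has density `m (t-1) a * q t a b`. -/
theorem forward_process_pair_marginal (d T : ℕ) (hT : 1 ≤ T)
    (q : ℕ → (Fin d → ℝ) → (Fin d → ℝ) → ℝ≥0∞)
    (hqmeas : ∀ t, 1 ≤ t → t ≤ T →
      Measurable (fun pr : (Fin d → ℝ) × (Fin d → ℝ) => q t pr.1 pr.2))
    (hqdens : ∀ t, 1 ≤ t → t ≤ T → ∀ z, (∫⁻ w, q t z w) = 1)
    (z0 : Fin d → ℝ) :
    ∀ t, 2 ≤ t → t ≤ T →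
      ∀ f : (Fin d → ℝ) → (Fin d → ℝ) → ℝ≥0∞,
        Measurable (fun pr : (Fin d → ℝ) × (Fin d → ℝ) => f pr.1 pr.2) →
        (∫⁻ z : Fin T → (Fin d → ℝ),
            (∏ s ∈ Finset.Icc 1 T, q s (traj z0 z (s - 1)) (traj z0 z s)) *
              f (traj z0 z (t - 1)) (traj z0 z t)) =
          ∫⁻ a, ∫⁻ b, marg q z0 (t - 1) a * q t a b * f a b := by
  intro t ht htT f hf
  clear hT
  induction T, htT using Nat.le_induction with
  | base =>
    obtain ⟨n, rfl⟩ : ∃ n, t = n + 1 + 1 := ⟨t - 2, by omega⟩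
    rw [lintegral_Q_succ q hqmeas z0 _ _ f hf]
    simp only [traj_snoc_last, Nat.add_sub_cancel]
    have e : ∀ (z : Fin (n + 1) → (Fin d → ℝ)) w,
        traj z0 (Fin.snoc z w : Fin (n + 1 + 1) → (Fin d → ℝ)) (n + 1) = traj z0 z (n + 1) :=
      fun z w => traj_snoc_le _ _ _ _ le_rfl
    simp only [e]
    have h3 := (hqmeas (n + 1 + 1) (by omega) le_rfl).mul hf
    rw [single_marg q z0 n (fun t h h' => hqmeas t h (by omega))
      (fun a => ∫⁻ w, q (n + 1 + 1) a w * f a w) h3.lintegral_prod_right']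
    refine lintegral_congr fun a => ?_
    rw [← lintegral_const_mul]
    · simp only [mul_assoc]
    · exact h3.comp (measurable_const.prodMk measurable_id)
  | succ T hT ih =>
    rw [← ih (fun t h h' => hqmeas t h (by omega)) (fun t h h' => hqdens t h (by omega)),
      lintegral_Q_succ q hqmeas z0 _ _ f hf]
    refine lintegral_congr fun z => ?_
    congr 1
    have e : ∀ w r, r ≤ T →
        traj z0 (Fin.snoc z w : Fin (T + 1) → (Fin d → ℝ)) r = traj z0 z r :=
      fun w r hr => traj_snoc_le _ _ _ _ hr
    simp only [e _ t hT, e _ (t - 1) (by omega)]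
    rw [lintegral_mul_const, hqdens _ (by omega) le_rfl, one_mul]
    exact (hqmeas _ (by omega) le_rfl).comp (measurable_const.prodMk measurable_id)
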